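/- Mecke equation for a Poisson process: let η be a Poisson process on Y with σ-finite intensity λ and h : N × Y → [0,∞] measurable. Then E[∫ h(η, y) η(dy)] = E[∫ h(η + δ_y, y) λ(dy)]. -/

import Mathlib

open MeasureTheory
open scoped NNReal ENNReal

variable {Ω Y : Type*} [MeasurableSpace Ω] [MeasurableSpace Y]

/-- `t ↦ e^{-t}` on `[0,∞]`, with `e^{-∞} = 0`. -/
noncomputable def expNeg (t : ℝ≥0∞) : ℝ≥0∞ :=
  if t = ⊤ then 0 else ENNReal.ofReal (Real.exp (-t.toReal))

/-- `η` is a Poisson process on `Y` with intensity measure `lam`, under the probability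
measure `P`, characterized by its Laplace functional. -/
def IsPoissonPP (P : Measure Ω) (η : Ω → Measure Y) (lam : Measure Y) : Prop :=
  Measurable η ∧
    ∀ v : Y → ℝ≥0∞, Measurable v →
      ∫⁻ ω, expNeg (∫⁻ x, v x ∂(η ω)) ∂P = expNeg (∫⁻ x, 1 - expNeg (v x) ∂lam)


open Filter Topology

lemma expNeg_coe (x : ℝ≥0) : expNeg x = ENNReal.ofReal (Real.exp (-(x : ℝ))) := by
  simp [expNeg]

lemma expNeg_top : expNeg ⊤ = 0 := by simp [expNeg]

lemma expNeg_zero : expNeg 0 = 1 := by simp [expNeg]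

lemma expNeg_add (a b : ℝ≥0∞) : expNeg (a + b) = expNeg a * expNeg b := by
  induction a with
  | top => simp [expNeg_top]
  | coe a =>
    induction b with
    | top => simp [expNeg_top]
    | coe b =>
      rw [← ENNReal.coe_add, expNeg_coe, expNeg_coe, expNeg_coe,
        ← ENNReal.ofReal_mul (Real.exp_nonneg _), ← Real.exp_add]
      congr 2
      push_cast
      ring

lemma expNeg_le_one (a : ℝ≥0∞) : expNeg a ≤ 1 := by
  induction a with
  | top => simp [expNeg_top]
  | coe a =>
    rw [expNeg_coe]
    exact ENNReal.ofReal_le_one.2 (Real.exp_le_one_iff.2 (by simp))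

lemma expNeg_ne_top (a : ℝ≥0∞) : expNeg a ≠ ⊤ :=
  ((expNeg_le_one a).trans_lt ENNReal.one_lt_top).ne

lemma measurable_expNeg : Measurable expNeg := by
  unfold expNeg
  refine Measurable.ite (measurableSet_singleton _) measurable_const ?_
  fun_prop

lemma one_sub_expNeg_le (a : ℝ≥0∞) : 1 - expNeg a ≤ a := by
  induction a with
  | top => simp
  | coe a =>
    rw [expNeg_coe, tsub_le_iff_right, ← ENNReal.ofReal_coe_nnreal,
      ← ENNReal.ofReal_add (by simp) (Real.exp_nonneg _), ← ENNReal.ofReal_one]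
    apply ENNReal.ofReal_le_ofReal
    have := Real.add_one_le_exp (-(a : ℝ))
    linarith

lemma mul_expNeg_le (a : ℝ≥0∞) : a * expNeg a ≤ 1 - expNeg a := by
  induction a with
  | top => simp [expNeg_top]
  | coe a =>
    apply ENNReal.le_sub_of_add_le_right (expNeg_ne_top _)
    rw [expNeg_coe, ← ENNReal.ofReal_coe_nnreal (p := a), ← ENNReal.ofReal_mul (by simp),
      ← ENNReal.ofReal_add (by positivity) (Real.exp_nonneg _), ← ENNReal.ofReal_one]
    apply ENNReal.ofReal_le_ofReal
    have h1 := Real.add_one_le_exp (a : ℝ)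
    have h2 : Real.exp (a : ℝ) * Real.exp (-(a : ℝ)) = 1 := by rw [← Real.exp_add]; simp
    nlinarith [Real.exp_pos (-(a : ℝ))]

lemma expNeg_injective : Function.Injective expNeg := by
  intro a b h
  induction a with
  | top =>
    induction b with
    | top => rfl
    | coe b =>
      rw [expNeg_top, expNeg_coe, eq_comm, ENNReal.ofReal_eq_zero] at h
      exact absurd h (not_le.2 (Real.exp_pos _))
  | coe a =>
    induction b with
    | top =>
      rw [expNeg_top, expNeg_coe, ENNReal.ofReal_eq_zero] at h
      exact absurd h (not_le.2 (Real.exp_pos _))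
    | coe b =>
      rw [expNeg_coe, expNeg_coe,
        ENNReal.ofReal_eq_ofReal_iff (Real.exp_nonneg _) (Real.exp_nonneg _)] at h
      have := Real.exp_injective h
      simpa using this

lemma tendsto_scaled_expNeg {x : ℕ → ℝ≥0∞} {a : ℝ≥0∞} (ha : a ≠ ⊤)
    (hx : Tendsto (fun n : ℕ => ((n : ℝ≥0∞) + 1) * x n) atTop (𝓝 a)) :
    Tendsto (fun n : ℕ => ((n : ℝ≥0∞) + 1) * (1 - expNeg (x n))) atTop (𝓝 a) := by
  have hinv : Tendsto (fun n : ℕ => ((n : ℝ≥0∞) + 1)⁻¹) atTop (𝓝 0) := by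
    have := ENNReal.tendsto_inv_nat_nhds_zero.comp (tendsto_add_atTop_nat 1)
    refine this.congr fun n => ?_
    simp
  have hx0 : Tendsto x atTop (𝓝 0) := by
    have := ENNReal.Tendsto.mul hinv (Or.inr ha) hx (Or.inr ENNReal.zero_ne_top)
    rw [zero_mul] at this
    refine this.congr fun n => ?_
    rw [← mul_assoc, ENNReal.inv_mul_cancel (by simp) (by finiteness), one_mul]
  have he : Tendsto (fun n => expNeg (x n)) atTop (𝓝 1) := by
    have h1 : Tendsto (fun n => 1 - x n) atTop (𝓝 (1 - 0)) :=
      ENNReal.Tendsto.sub tendsto_const_nhds hx0 (Or.inl ENNReal.one_ne_top)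
    rw [tsub_zero] at h1
    refine tendsto_of_tendsto_of_tendsto_of_le_of_le h1 tendsto_const_nhds (fun n => ?_)
      (fun n => expNeg_le_one _)
    have := one_sub_expNeg_le (x n)
    rw [tsub_le_iff_left] at this
    exact tsub_le_iff_left.2 (by rwa [add_comm] at this)
  have h2 := ENNReal.Tendsto.mul hx (Or.inr ENNReal.one_ne_top) he (Or.inr ha)
  rw [mul_one] at h2
  refine tendsto_of_tendsto_of_tendsto_of_le_of_le h2 hx (fun n => ?_) (fun n => ?_)
  · simp only [mul_assoc]
    gcongr
    exact mul_expNeg_le _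
  · simp only
    gcongr
    exact one_sub_expNeg_le _

lemma scaled_expNeg_le (n : ℕ) (a : ℝ≥0∞) :
    ((n : ℝ≥0∞) + 1) * (1 - expNeg (((n : ℝ≥0∞) + 1)⁻¹ * a)) ≤ a := by
  calc _ ≤ ((n : ℝ≥0∞) + 1) * (((n : ℝ≥0∞) + 1)⁻¹ * a) := by
        gcongr; exact one_sub_expNeg_le _
    _ = a := by rw [← mul_assoc, ENNReal.mul_inv_cancel (by simp) (by finiteness), one_mul]

lemma tendsto_scaled_expNeg' {a : ℝ≥0∞} (ha : a ≠ ⊤) :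
    Tendsto (fun n : ℕ => ((n : ℝ≥0∞) + 1) * (1 - expNeg (((n : ℝ≥0∞) + 1)⁻¹ * a))) atTop (𝓝 a) := by
  apply tendsto_scaled_expNeg ha
  refine tendsto_const_nhds.congr fun n => ?_
  rw [← mul_assoc, ENNReal.mul_inv_cancel (by simp) (by finiteness), one_mul]

lemma scaled_expNeg_top (n : ℕ) :
    ((n : ℝ≥0∞) + 1) * (1 - expNeg (((n : ℝ≥0∞) + 1)⁻¹ * ⊤)) = n + 1 := by
  rw [ENNReal.mul_top (by simp), expNeg_top]; simp

lemma tendsto_scaled_expNeg_top :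
    Tendsto (fun n : ℕ => ((n : ℝ≥0∞) + 1) * (1 - expNeg (((n : ℝ≥0∞) + 1)⁻¹ * ⊤)))
      atTop (𝓝 ⊤) := by
  simp only [scaled_expNeg_top]
  have := ENNReal.tendsto_nat_nhds_top.comp (tendsto_add_atTop_nat 1)
  refine this.congr fun n => ?_
  simp

/-- The finite-difference identity behind the Laplace form of Mecke. -/
lemma laplace_diff {P : Measure Ω} [IsProbabilityMeasure P]
    {lam : Measure Y} {η : Ω → Measure Y} (hη : IsPoissonPP P η lam)
    {v : Y → ℝ≥0∞} (hv : Measurable v) {B : Set Y} (hB : MeasurableSet B) (t : ℝ≥0∞) :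
    ∫⁻ ω, expNeg (∫⁻ x, v x ∂(η ω)) * (1 - expNeg (t * η ω B)) ∂P =
      expNeg (∫⁻ x, 1 - expNeg (v x) ∂lam) *
        (1 - expNeg ((1 - expNeg t) * ∫⁻ x in B, expNeg (v x) ∂lam)) := by
  have hm : ∀ u : Y → ℝ≥0∞, Measurable u → Measurable fun ω => expNeg (∫⁻ x, u x ∂(η ω)) :=
    fun u hu => measurable_expNeg.comp ((Measure.measurable_lintegral hu).comp hη.1)
  have hi : Measurable (B.indicator fun _ => t) := measurable_const.indicator hB
  have hu : Measurable (fun x => v x + B.indicator (fun _ => t) x) := hv.add hi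
  have e1 : ∀ ω, expNeg (∫⁻ x, v x ∂(η ω)) * (1 - expNeg (t * η ω B)) =
      expNeg (∫⁻ x, v x ∂(η ω)) - expNeg (∫⁻ x, v x + B.indicator (fun _ => t) x ∂(η ω)) := by
    intro ω
    rw [lintegral_add_left hv, lintegral_indicator_const hB, expNeg_add,
      ENNReal.mul_sub (fun _ _ => expNeg_ne_top _), mul_one]
  simp_rw [e1]
  rw [lintegral_sub (hm _ hu), hη.2 v hv, hη.2 _ hu]
  · have e2 : ∫⁻ x, 1 - expNeg (v x + B.indicator (fun _ => t) x) ∂lam =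
        (∫⁻ x, 1 - expNeg (v x) ∂lam) + (1 - expNeg t) * ∫⁻ x in B, expNeg (v x) ∂lam := by
      have hev : Measurable fun x => expNeg (v x) := measurable_expNeg.comp hv
      rw [← lintegral_const_mul _ hev, ← lintegral_indicator hB,
        ← lintegral_add_left (f := fun x => 1 - expNeg (v x)) (measurable_const.sub hev)]
      refine lintegral_congr fun x => ?_
      by_cases hx : x ∈ B
      · simp only [hx, Set.indicator_of_mem, expNeg_add]
        rw [mul_comm (1 - expNeg t), ENNReal.mul_sub (fun _ _ => expNeg_ne_top _), mul_one,
          tsub_add_tsub_cancel (expNeg_le_one _)]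
        exact mul_le_of_le_one_right' (expNeg_le_one _)
      · simp [hx]
    rw [e2, expNeg_add, ENNReal.mul_sub (fun _ _ => expNeg_ne_top _), mul_one]
  · rw [hη.2 _ hu]; exact expNeg_ne_top _
  · refine Eventually.of_forall fun ω => ?_
    simp only [lintegral_add_left hv, expNeg_add]
    exact mul_le_of_le_one_right' (expNeg_le_one _)

lemma laplace_diff_tendsto {P : Measure Ω} [IsProbabilityMeasure P]
    {lam : Measure Y} {η : Ω → Measure Y} (hη : IsPoissonPP P η lam)
    {v : Y → ℝ≥0∞} (hv : Measurable v) {B : Set Y} (hB : MeasurableSet B) (hlB : lam B ≠ ⊤) :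
    Tendsto (fun n : ℕ => ∫⁻ ω, expNeg (∫⁻ x, v x ∂(η ω)) *
        (((n : ℝ≥0∞) + 1) * (1 - expNeg (((n : ℝ≥0∞) + 1)⁻¹ * η ω B))) ∂P) atTop
      (𝓝 (expNeg (∫⁻ x, 1 - expNeg (v x) ∂lam) * ∫⁻ x in B, expNeg (v x) ∂lam)) := by
  have hI : ∫⁻ x in B, expNeg (v x) ∂lam ≠ ⊤ := by
    refine ne_top_of_le_ne_top hlB ?_
    calc _ ≤ ∫⁻ x in B, 1 ∂lam := lintegral_mono fun x => expNeg_le_one _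
      _ = lam B := by simp
  have h1 := tendsto_scaled_expNeg' ENNReal.one_ne_top
  simp only [mul_one] at h1
  have h2 : Tendsto (fun n : ℕ => ((n : ℝ≥0∞) + 1) *
      ((1 - expNeg (((n : ℝ≥0∞) + 1)⁻¹)) * ∫⁻ x in B, expNeg (v x) ∂lam)) atTop
      (𝓝 (∫⁻ x in B, expNeg (v x) ∂lam)) := by
    have := ENNReal.Tendsto.mul_const h1 (b := ∫⁻ x in B, expNeg (v x) ∂lam) (Or.inr hI)
    simpa [mul_assoc] using this
  have h3 := ENNReal.Tendsto.const_mul (tendsto_scaled_expNeg hI h2)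
    (a := expNeg (∫⁻ x, 1 - expNeg (v x) ∂lam)) (Or.inr (expNeg_ne_top _))
  refine h3.congr fun n => ?_
  rw [mul_left_comm, ← laplace_diff hη hv hB, ← lintegral_const_mul']
  · refine lintegral_congr fun ω => ?_
    rw [mul_left_comm]
  · finiteness

lemma lintegral_eta_le {P : Measure Ω} [IsProbabilityMeasure P]
    {lam : Measure Y} {η : Ω → Measure Y} (hη : IsPoissonPP P η lam)
    {B : Set Y} (hB : MeasurableSet B) (hlB : lam B ≠ ⊤) :
    ∫⁻ ω, η ω B ∂P ≤ lam B := by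
  have hmB : Measurable fun ω => η ω B := (Measure.measurable_coe hB).comp hη.1
  have h := laplace_diff_tendsto hη (v := fun _ => 0) measurable_const hB hlB
  simp only [lintegral_zero, expNeg_zero, one_mul, tsub_self, setLIntegral_one] at h
  calc ∫⁻ ω, η ω B ∂P = ∫⁻ ω, liminf (fun n : ℕ =>
        (((n : ℝ≥0∞) + 1) * (1 - expNeg (((n : ℝ≥0∞) + 1)⁻¹ * η ω B)))) atTop ∂P := by
        refine lintegral_congr fun ω => ?_
        by_cases ht : η ω B = ⊤
        · rw [ht]; exact tendsto_scaled_expNeg_top.liminf_eq.symm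
        · exact (tendsto_scaled_expNeg' ht).liminf_eq.symm
    _ ≤ liminf (fun n : ℕ => ∫⁻ ω, 
        (((n : ℝ≥0∞) + 1) * (1 - expNeg (((n : ℝ≥0∞) + 1)⁻¹ * η ω B))) ∂P) atTop := by
        refine lintegral_liminf_le fun n => ?_
        exact (measurable_const.sub (measurable_expNeg.comp (hmB.const_mul _))).const_mul _
    _ = lam B := h.liminf_eq

lemma laplace_mecke {P : Measure Ω} [IsProbabilityMeasure P]
    {lam : Measure Y} {η : Ω → Measure Y} (hη : IsPoissonPP P η lam)
    {v : Y → ℝ≥0∞} (hv : Measurable v) {B : Set Y} (hB : MeasurableSet B) (hlB : lam B ≠ ⊤) :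
    ∫⁻ ω, expNeg (∫⁻ x, v x ∂(η ω)) * η ω B ∂P =
      expNeg (∫⁻ x, 1 - expNeg (v x) ∂lam) * ∫⁻ x in B, expNeg (v x) ∂lam := by
  have hmB : Measurable fun ω => η ω B := (Measure.measurable_coe hB).comp hη.1
  have hm : Measurable fun ω => expNeg (∫⁻ x, v x ∂(η ω)) :=
    measurable_expNeg.comp ((Measure.measurable_lintegral hv).comp hη.1)
  have hfin : ∫⁻ ω, η ω B ∂P ≠ ⊤ := ne_top_of_le_ne_top hlB (lintegral_eta_le hη hB hlB)
  refine tendsto_nhds_unique ?_ (laplace_diff_tendsto hη hv hB hlB)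
  refine tendsto_lintegral_of_dominated_convergence (fun ω => η ω B) (fun n => ?_) (fun n => ?_)
    hfin ?_
  · exact hm.mul
      ((measurable_const.sub (measurable_expNeg.comp (hmB.const_mul _))).const_mul _)
  · refine Eventually.of_forall fun ω => ?_
    exact (mul_le_of_le_one_left' (expNeg_le_one _)).trans (scaled_expNeg_le n _)
  · filter_upwards [ae_lt_top hmB hfin] with ω hω
    exact ENNReal.Tendsto.const_mul (tendsto_scaled_expNeg' hω.ne) (Or.inr (expNeg_ne_top _))

/-- The coordinates `μ ↦ e^{-μ(A)}`. -/
noncomputable def expCoord (μ : Measure Y) (A : {A : Set Y // MeasurableSet A}) : unitInterval :=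
  ⟨(expNeg (μ A.1)).toReal, ENNReal.toReal_nonneg,
    ENNReal.toReal_le_of_le_ofReal zero_le_one (by simpa using expNeg_le_one _)⟩

lemma measurable_expNeg_lintegral {v : Y → ℝ≥0∞} (hv : Measurable v) :
    Measurable fun μ : Measure Y => expNeg (∫⁻ x, v x ∂μ) :=
  measurable_expNeg.comp (Measure.measurable_lintegral hv)

lemma measurable_expCoord : Measurable (expCoord (Y := Y)) := by
  refine measurable_pi_lambda _ fun A => Measurable.subtype_mk ?_
  exact (measurable_expNeg.comp (Measure.measurable_coe A.2)).ennreal_toReal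

lemma measurableEmbedding_expNeg_toReal :
    MeasurableEmbedding fun t : ℝ≥0∞ => (expNeg t).toReal := by
  refine Measurable.measurableEmbedding measurable_expNeg.ennreal_toReal fun a b h => ?_
  exact expNeg_injective ((ENNReal.toReal_eq_toReal_iff' (expNeg_ne_top _) (expNeg_ne_top _)).1 h)

lemma measure_space_le_comap :
    (Measure.instMeasurableSpace : MeasurableSpace (Measure Y)) ≤
      MeasurableSpace.comap expCoord inferInstance := by
  refine iSup₂_le fun A hA => ?_
  have h1 : @Measurable _ _ (MeasurableSpace.comap (expCoord (Y := Y)) inferInstance) _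
      (fun μ : Measure Y => μ A) := by
    rw [← measurableEmbedding_expNeg_toReal.measurable_comp_iff]
    have h2 : Measurable fun x : {A : Set Y // MeasurableSet A} → unitInterval =>
        ((x ⟨A, hA⟩ : unitInterval) : ℝ) := measurable_subtype_coe.comp (measurable_pi_apply _)
    exact h2.comp (comap_measurable _)
  exact h1.comap_le

lemma integral_expNeg_eq {m₁ m₂ : Measure (Measure Y)}
    (h : ∀ v : Y → ℝ≥0∞, Measurable v →
      ∫⁻ μ, expNeg (∫⁻ x, v x ∂μ) ∂m₁ = ∫⁻ μ, expNeg (∫⁻ x, v x ∂μ) ∂m₂)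
    {v : Y → ℝ≥0∞} (hv : Measurable v) :
    ∫ μ, (expNeg (∫⁻ x, v x ∂μ)).toReal ∂m₁ = ∫ μ, (expNeg (∫⁻ x, v x ∂μ)).toReal ∂m₂ := by
  rw [integral_toReal (measurable_expNeg_lintegral hv).aemeasurable
      (Eventually.of_forall fun _ => (expNeg_ne_top _).lt_top),
    integral_toReal (measurable_expNeg_lintegral hv).aemeasurable
      (Eventually.of_forall fun _ => (expNeg_ne_top _).lt_top), h v hv]

open BoundedContinuousFunction in
/-- The monomials. -/
def expMonoid (I : Finset {A : Set Y // MeasurableSet A}) :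
    Submonoid ((I → unitInterval) →ᵇ ℝ) where
  carrier := {f | ∃ v : Y → ℝ≥0∞, Measurable v ∧
    ∀ μ : Measure Y, f (I.restrict (expCoord μ)) = (expNeg (∫⁻ x, v x ∂μ)).toReal}
  one_mem' := ⟨fun _ => 0, measurable_const, fun μ => by simp [expNeg_zero]⟩
  mul_mem' := by
    rintro f g ⟨v, hv, hf⟩ ⟨w, hw, hg⟩
    refine ⟨fun x => v x + w x, hv.add hw, fun μ => ?_⟩
    rw [BoundedContinuousFunction.mul_apply, hf, hg, lintegral_add_left hv, expNeg_add,
      ENNReal.toReal_mul]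

lemma map_restrict_eq {m₁ m₂ : Measure (Measure Y)} [IsFiniteMeasure m₁] [IsFiniteMeasure m₂]
    (h : ∀ v : Y → ℝ≥0∞, Measurable v →
      ∫⁻ μ, expNeg (∫⁻ x, v x ∂μ) ∂m₁ = ∫⁻ μ, expNeg (∫⁻ x, v x ∂μ) ∂m₂)
    (I : Finset {A : Set Y // MeasurableSet A}) :
    (m₁.map expCoord).map I.restrict = (m₂.map expCoord).map I.restrict := by
  have hr : Measurable (I.restrict : ({A : Set Y // MeasurableSet A} → unitInterval) → _) :=
    Finset.measurable_restrict I
  rw [Measure.map_map hr measurable_expCoord, Measure.map_map hr measurable_expCoord]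
  have hΦ := hr.comp (measurable_expCoord (Y := Y))
  let A : StarSubalgebra ℝ (BoundedContinuousFunction (I → unitInterval) ℝ) :=
    { Algebra.adjoin ℝ (expMonoid I : Set (BoundedContinuousFunction (I → unitInterval) ℝ)) with
      star_mem' := by
        intro a ha
        have hs : star a = a := by ext x; simp
        rw [hs]
        exact ha }
  refine ext_of_forall_mem_subalgebra_integral_eq_of_polish (A := A) ?_ ?_
  · intro x y hxy
    obtain ⟨i, hi⟩ := Function.ne_iff.1 hxy
    let f : BoundedContinuousFunction (I → unitInterval) ℝ :=
      BoundedContinuousFunction.mkOfCompact ⟨fun x => (x i : ℝ), by fun_prop⟩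
    have hf : f ∈ expMonoid I := by
      refine ⟨i.1.1.indicator fun _ => 1, measurable_const.indicator i.1.2, fun μ => ?_⟩
      rw [lintegral_indicator_const i.1.2, one_mul]
      rfl
    refine ⟨f, ⟨f, ⟨f, Algebra.subset_adjoin hf, rfl⟩, rfl⟩, ?_⟩
    exact fun h => hi (Subtype.ext h)
  · intro g hg
    have hg' : g ∈ Submodule.span ℝ
        (expMonoid I : Set (BoundedContinuousFunction (I → unitInterval) ℝ)) := by
      have h1 : g ∈ Subalgebra.toSubmodule (Algebra.adjoin ℝ
        (expMonoid I : Set (BoundedContinuousFunction (I → unitInterval) ℝ))) := hg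
      rwa [Algebra.adjoin_eq_span, Submonoid.closure_eq] at h1
    have hint : ∀ f : BoundedContinuousFunction (I → unitInterval) ℝ,
        ∀ m : Measure (Measure Y), IsFiniteMeasure m →
        Integrable f (m.map (I.restrict ∘ expCoord)) := by
      intro f m _
      exact f.integrable _
    clear hg
    induction hg' using Submodule.span_induction with
    | mem f hf =>
      obtain ⟨v, hv, hf⟩ := hf
      rw [integral_map hΦ.aemeasurable f.continuous.aestronglyMeasurable,
        integral_map hΦ.aemeasurable f.continuous.aestronglyMeasurable]
      simp only [Function.comp_apply, hf]
      exact integral_expNeg_eq h hv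
    | zero => simp
    | add f g hf hg ihf ihg =>
      simp only [BoundedContinuousFunction.coe_add, Pi.add_apply]
      rw [integral_add (hint _ _ inferInstance) (hint _ _ inferInstance),
        integral_add (hint _ _ inferInstance) (hint _ _ inferInstance),
        ihf, ihg]
    | smul a f hf ihf =>
      simp only [BoundedContinuousFunction.coe_smul]
      rw [integral_smul, integral_smul, ihf]

lemma ext_of_laplace {m₁ m₂ : Measure (Measure Y)} [IsFiniteMeasure m₁] [IsFiniteMeasure m₂]
    (h : ∀ v : Y → ℝ≥0∞, Measurable v →
      ∫⁻ μ, expNeg (∫⁻ x, v x ∂μ) ∂m₁ = ∫⁻ μ, expNeg (∫⁻ x, v x ∂μ) ∂m₂) : m₁ = m₂ := by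
  have hΦ : m₁.map expCoord = m₂.map expCoord := by
    refine IsProjectiveLimit.unique (P := fun I => (m₂.map expCoord).map I.restrict)
      (fun I => map_restrict_eq h I) (fun I => rfl)
  ext S hS
  obtain ⟨T, hT, rfl⟩ := measure_space_le_comap S hS
  rw [← Measure.map_apply measurable_expCoord hT, hΦ, Measure.map_apply measurable_expCoord hT]

open ProbabilityTheory in
/-- A Poisson process agrees almost surely with an s-finite kernel. -/
lemma exists_sfinite_kernel {P : Measure Ω} [IsProbabilityMeasure P]
    {lam : Measure Y} [SigmaFinite lam] {η : Ω → Measure Y} (hη : IsPoissonPP P η lam) :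
    ∃ κ : Kernel Ω Y, IsSFiniteKernel κ ∧ ∀ᵐ ω ∂P, κ ω = η ω := by
  let D : ℕ → Set Y := disjointed (spanningSets lam)
  have hD : ∀ n, MeasurableSet (D n) := fun n =>
    MeasurableSet.disjointed (fun k => measurableSet_spanningSets lam k) n
  have hlD : ∀ n, lam (D n) ≠ ⊤ := fun n =>
    ne_top_of_le_ne_top (measure_spanningSets_lt_top lam n).ne
      (measure_mono (disjointed_subset _ _))
  have hmD : ∀ n, Measurable fun ω => η ω (D n) := fun n =>
    (Measure.measurable_coe (hD n)).comp hη.1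
  let s : ℕ → ℕ → Set Ω := fun n k => {ω | (k : ℝ≥0∞) ≤ η ω (D n) ∧ η ω (D n) < k + 1}
  have hs : ∀ n k, MeasurableSet (s n k) := fun n k =>
    (measurableSet_le measurable_const (hmD n)).inter
      (measurableSet_lt (hmD n) measurable_const)
  let κ₀ : Kernel Ω Y := ⟨η, hη.1⟩
  classical
  let κ₁ : ℕ → ℕ → Kernel Ω Y := fun n k => Kernel.piecewise (hs n k) (κ₀.restrict (hD n)) 0
  have hκ₁ : ∀ n k, IsFiniteKernel (κ₁ n k) := by
    intro n k
    refine ⟨⟨k + 1, by finiteness, fun ω => ?_⟩⟩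
    rw [Kernel.piecewise_apply']
    split_ifs with h
    · rw [Kernel.restrict_apply' _ _ _ MeasurableSet.univ, Set.univ_inter]
      exact h.2.le
    · simp
  refine ⟨Kernel.sum fun n => Kernel.sum (κ₁ n), inferInstance, ?_⟩
  have hae : ∀ᵐ ω ∂P, ∀ n, η ω (D n) < ⊤ := ae_all_iff.2 fun n =>
    ae_lt_top (hmD n) (ne_top_of_le_ne_top (hlD n) (lintegral_eta_le hη (hD n) (hlD n)))
  filter_upwards [hae] with ω hω
  have h1 : ∀ n, Kernel.sum (κ₁ n) ω = (η ω).restrict (D n) := by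
    intro n
    ext t ht
    rw [Kernel.sum_apply' _ _ ht]
    obtain ⟨a, ha⟩ : ∃ a : ℝ≥0, (a : ℝ≥0∞) = η ω (D n) :=
      ⟨_, ENNReal.coe_toNNReal (hω n).ne⟩
    rw [tsum_eq_single ⌊a⌋₊]
    · rw [Kernel.piecewise_apply', if_pos, Kernel.restrict_apply]
      · rfl
      · refine ⟨?_, ?_⟩
        · rw [← ha]
          exact_mod_cast Nat.floor_le (zero_le (a := a))
        · rw [← ha]
          exact_mod_cast Nat.lt_floor_add_one a
    · intro k hk
      rw [Kernel.piecewise_apply', if_neg]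
      · simp
      · rintro ⟨h1, h2⟩
        rw [← ha] at h1 h2
        apply hk
        symm
        rw [Nat.floor_eq_iff (zero_le (a := a))]
        exact ⟨by exact_mod_cast h1, by exact_mod_cast h2⟩
  rw [Kernel.sum_apply]
  simp only [h1]
  rw [← Measure.restrict_iUnion (disjoint_disjointed _) hD, iUnion_disjointed,
    iUnion_spanningSets, Measure.restrict_univ]

lemma measurable_add_dirac {η : Ω → Measure Y} (hη : Measurable η) :
    Measurable fun p : Ω × Y => η p.1 + Measure.dirac p.2 :=
  (hη.comp measurable_fst).add (Measure.measurable_dirac.comp measurable_snd)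

lemma mecke_set {P : Measure Ω} [IsProbabilityMeasure P]
    {lam : Measure Y} [SigmaFinite lam] {η : Ω → Measure Y} (hη : IsPoissonPP P η lam)
    {B : Set Y} (hB : MeasurableSet B) (hlB : lam B ≠ ⊤) :
    (P.withDensity fun ω => η ω B).map η =
      (P.prod (lam.restrict B)).map fun p => η p.1 + Measure.dirac p.2 := by
  have hmB : Measurable fun ω => η ω B := (Measure.measurable_coe hB).comp hη.1
  have : IsFiniteMeasure (P.withDensity fun ω => η ω B) :=
    isFiniteMeasure_withDensity (ne_top_of_le_ne_top hlB (lintegral_eta_le hη hB hlB))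
  have : IsFiniteMeasure (lam.restrict B) := isFiniteMeasure_restrict.2 hlB
  refine ext_of_laplace fun v hv => ?_
  have hm := measurable_expNeg_lintegral hv
  have hm' : Measurable fun ω => expNeg (∫⁻ x, v x ∂(η ω)) := hm.comp hη.1
  rw [lintegral_map hm hη.1, lintegral_map hm (measurable_add_dirac hη.1),
    lintegral_withDensity_eq_lintegral_mul _ hmB hm',
    lintegral_prod (fun p : Ω × Y => expNeg (∫⁻ x, v x ∂(η p.1 + Measure.dirac p.2)))
      (hm.comp (measurable_add_dirac hη.1)).aemeasurable]
  simp only [Pi.mul_apply, lintegral_add_measure, lintegral_dirac' _ hv, expNeg_add]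
  have hev : Measurable fun x => expNeg (v x) := measurable_expNeg.comp hv
  simp only [lintegral_const_mul _ hev]
  rw [lintegral_mul_const _ hm', hη.2 v hv, ← laplace_mecke hη hv hB hlB]
  exact lintegral_congr fun ω => mul_comm _ _


/-- The Mecke equation for a Poisson process `η` with σ-finite intensity `λ`:
`E[∫ h(η, y) η(dy)] = E[∫ h(η + δ_y, y) λ(dy)]` for measurable `h : N × Y → [0,∞]`. -/
theorem mecke_equation (P : Measure Ω) [IsProbabilityMeasure P]
    (lam : Measure Y) [SigmaFinite lam] (η : Ω → Measure Y) (hη : IsPoissonPP P η lam)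
    (h : Measure Y × Y → ℝ≥0∞) (hh : Measurable h) :
    ∫⁻ ω, ∫⁻ y, h (η ω, y) ∂(η ω) ∂P =
      ∫⁻ ω, ∫⁻ y, h (η ω + Measure.dirac y, y) ∂lam ∂P := by
  have hη1 := hη.1
  obtain ⟨κ, hκ, hκη⟩ := exists_sfinite_kernel hη
  have hf₁ : Measurable fun p : Ω × Y => (η p.1, p.2) :=
    (hη1.comp measurable_fst).prodMk measurable_snd
  have hf₂ : Measurable fun p : Ω × Y => (η p.1 + Measure.dirac p.2, p.2) :=
    (measurable_add_dirac hη1).prodMk measurable_snd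
  let C₁ : Measure (Measure Y × Y) := (P.compProd κ).map fun p => (η p.1, p.2)
  let C₂ : Measure (Measure Y × Y) :=
    (P.prod lam).map fun p => (η p.1 + Measure.dirac p.2, p.2)
  have hmB : ∀ B, MeasurableSet B → Measurable fun ω => η ω B := fun B hB =>
    (Measure.measurable_coe hB).comp hη1
  have hC₁ : ∀ (S : Set (Measure Y)) (B : Set Y), MeasurableSet S → MeasurableSet B →
      C₁ (S ×ˢ B) = (P.withDensity fun ω => η ω B).map η S := by
    intro S B hS hB
    have e : (fun p : Ω × Y => (η p.1, p.2)) ⁻¹' (S ×ˢ B) = (η ⁻¹' S) ×ˢ B := by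
      ext p; simp
    rw [Measure.map_apply hf₁ (hS.prod hB), e, Measure.compProd_apply_prod (hη1 hS) hB,
      Measure.map_apply hη1 hS, withDensity_apply _ (hη1 hS)]
    refine lintegral_congr_ae (ae_restrict_of_ae ?_)
    filter_upwards [hκη] with ω hω
    rw [hω]
  have hC₂ : ∀ (S : Set (Measure Y)) (B : Set Y), MeasurableSet S → MeasurableSet B →
      C₂ (S ×ˢ B) =
        (P.prod (lam.restrict B)).map (fun p => η p.1 + Measure.dirac p.2) S := by
    intro S B hS hB
    have e : (fun p : Ω × Y => (η p.1 + Measure.dirac p.2, p.2)) ⁻¹' (S ×ˢ B) =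
        ((fun p : Ω × Y => η p.1 + Measure.dirac p.2) ⁻¹' S) ∩ (Set.univ ×ˢ B) := by
      ext p; simp
    have e2 : P.prod (lam.restrict B) = (P.prod lam).restrict (Set.univ ×ˢ B) := by
      rw [← Measure.prod_restrict, Measure.restrict_univ]
    rw [Measure.map_apply hf₂ (hS.prod hB), e, Measure.map_apply (measurable_add_dirac hη1) hS,
      e2, Measure.restrict_apply (measurable_add_dirac hη1 hS)]
  have hrect : ∀ (S : Set (Measure Y)) (B : Set Y), MeasurableSet S → MeasurableSet B →
      lam B ≠ ⊤ → C₁ (S ×ˢ B) = C₂ (S ×ˢ B) := by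
    intro S B hS hB hlB
    rw [hC₁ S B hS hB, hC₂ S B hS hB, mecke_set hη hB hlB]
  have hC : C₁ = C₂ := by
    have hU : (⋃ n, (Set.univ : Set (Measure Y)) ×ˢ spanningSets lam n) = Set.univ := by
      rw [← Set.prod_iUnion, iUnion_spanningSets, Set.univ_prod_univ]
    refine (Measure.ext_iff_of_iUnion_eq_univ hU).2 fun n => ?_
    have hBn := measurableSet_spanningSets lam n
    have hln := (measure_spanningSets_lt_top lam n).ne
    have : IsFiniteMeasure (C₁.restrict (Set.univ ×ˢ spanningSets lam n)) := by
      refine isFiniteMeasure_restrict.2 ?_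
      rw [hC₁ _ _ MeasurableSet.univ hBn, Measure.map_apply hη1 MeasurableSet.univ,
        Set.preimage_univ, withDensity_apply _ MeasurableSet.univ, Measure.restrict_univ]
      exact ne_top_of_le_ne_top hln (lintegral_eta_le hη hBn hln)
    refine Measure.ext_prod fun {S T} hS hT => ?_
    rw [Measure.restrict_apply (hS.prod hT), Measure.restrict_apply (hS.prod hT),
      Set.prod_inter_prod, Set.inter_univ]
    exact hrect _ _ hS (hT.inter hBn)
      (ne_top_of_le_ne_top hln (measure_mono Set.inter_subset_right))
  calc ∫⁻ ω, ∫⁻ y, h (η ω, y) ∂(η ω) ∂P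
      = ∫⁻ ω, ∫⁻ y, h (η ω, y) ∂(κ ω) ∂P := by
        refine lintegral_congr_ae ?_
        filter_upwards [hκη] with ω hω
        rw [hω]
    _ = ∫⁻ q, h q ∂C₁ := by
        rw [lintegral_map hh hf₁,
          Measure.lintegral_compProd (f := fun p => h (η p.1, p.2)) (hh.comp hf₁)]
    _ = ∫⁻ q, h q ∂C₂ := by rw [hC]
    _ = ∫⁻ ω, ∫⁻ y, h (η ω + Measure.dirac y, y) ∂lam ∂P := by
        rw [lintegral_map hh hf₂,
          lintegral_prod (fun p : Ω × Y => h (η p.1 + Measure.dirac p.2, p.2))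
            (hh.comp hf₂).aemeasurable]
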